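/- arXiv:2604.22488 — 2 statements merged into one kernel-verified Lean document; each statement's English description precedes it below -/
import Mathlib

section
/- Let n ∈ ℕ and let 𝓜 be a nonempty set of positive semidefinite n×n complex matrices. Then there exists a positive semidefinite matrix M which is a maximal lower bound of 𝓜 with respect to the Löwner order on Hermitian n×n matrices. -/
open scoped ComplexOrder

/-- Löwner's order on Hermitian matrices: `S ≤ T` iff `T - S` is positive semidefinite. -/
def matLoewnerLE {n : ℕ} (S T : Matrix (Fin n) (Fin n) ℂ) : Prop := (T - S).PosSemidef

open scoped MatrixOrder Matrix.Norms.L2Operator in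
theorem aux_compact (n : ℕ) (M : Set (Matrix (Fin n) (Fin n) ℂ)) (hne : M.Nonempty) :
    IsCompact {L : Matrix (Fin n) (Fin n) ℂ | L.PosSemidef ∧ ∀ A ∈ M, (A - L).PosSemidef} := by
  have hE : {L : Matrix (Fin n) (Fin n) ℂ | L.PosSemidef ∧ ∀ A ∈ M, (A - L).PosSemidef}
      = {L | 0 ≤ L ∧ ∀ A ∈ M, L ≤ A} := by
    ext L
    simp only [Set.mem_setOf_eq, Matrix.le_iff, sub_zero]
  rw [hE]
  obtain ⟨A, hA⟩ := hne
  haveI : ProperSpace (Matrix (Fin n) (Fin n) ℂ) := FiniteDimensional.proper ℂ _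
  apply Metric.isCompact_of_isClosed_isBounded
  · have : {L : Matrix (Fin n) (Fin n) ℂ | 0 ≤ L ∧ ∀ A ∈ M, L ≤ A}
        = Set.Ici 0 ∩ ⋂ A ∈ M, Set.Iic A := by
      ext L; simp
    rw [this]
    exact isClosed_Ici.inter (isClosed_biInter fun A _ => isClosed_Iic)
  · refine (Metric.isBounded_closedBall (x := 0) (r := ‖A‖)).subset ?_
    rintro L ⟨h0, h⟩
    rw [mem_closedBall_zero_iff]
    exact CStarAlgebra.norm_le_norm_of_nonneg_of_le h0 (h A hA)

/-- Theorem 4.11: every nonempty set of positive semidefinite `n × n` complex matrices has a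
positive semidefinite maximal lower bound (maximal in the set of Hermitian lower bounds with
respect to the Löwner order). -/
theorem stmt12 (n : ℕ) (M : Set (Matrix (Fin n) (Fin n) ℂ)) (hne : M.Nonempty)
    (hpos : ∀ A ∈ M, A.PosSemidef) :
    ∃ Mo : Matrix (Fin n) (Fin n) ℂ, Mo.PosSemidef ∧
      (Mo.IsHermitian ∧ ∀ A ∈ M, matLoewnerLE Mo A) ∧
      (∀ L : Matrix (Fin n) (Fin n) ℂ, L.IsHermitian → (∀ A ∈ M, matLoewnerLE L A) →
        matLoewnerLE Mo L → L = Mo) := by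
  obtain ⟨Mo, ⟨h0, hlb⟩, hmax⟩ := (aux_compact n M hne).exists_isMaxOn
    ⟨0, Matrix.PosSemidef.zero, fun A hA => by simpa using hpos A hA⟩
    (f := fun L => (Matrix.trace L).re)
    (Complex.continuous_re.comp (continuous_id.matrix_trace)).continuousOn
  refine ⟨Mo, h0, ⟨h0.1, hlb⟩, fun L _ hL hle => ?_⟩
  have hd : (L - Mo).PosSemidef := hle
  have hLp : L.PosSemidef := by simpa using hd.add h0
  have h1 : (Matrix.trace L).re ≤ (Matrix.trace Mo).re := hmax ⟨hLp, hL⟩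
  have h2 := Complex.nonneg_iff.1 hd.trace_nonneg
  have h3 : (L - Mo).trace = 0 := by
    apply Complex.ext
    · have := h2.1
      rw [Matrix.trace_sub, Complex.sub_re] at this ⊢
      simp only [Complex.zero_re]
      linarith
    · exact h2.2.symm
  exact sub_eq_zero.1 (hd.trace_eq_zero_iff.1 h3)
end

section
/- Let 𝓜 be a nonempty set of pairwise commuting Hermitian n×n complex matrices which is bounded from below in the Löwner order. Then there exists a unique maximal lower bound M of 𝓜 commuting with all matrices of 𝓜. -/
open scoped ComplexOrder

open Matrix in
theorem joint_diag {n : ℕ} (S : Set (Matrix (Fin n) (Fin n) ℂ))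
    (hherm : ∀ A ∈ S, A.IsHermitian)
    (hcomm : ∀ A ∈ S, ∀ B ∈ S, A * B = B * A) :
    ∃ (U : Matrix (Fin n) (Fin n) ℂ) (d : Matrix (Fin n) (Fin n) ℂ → Fin n → ℝ),
      Uᴴ * U = 1 ∧ U * Uᴴ = 1 ∧
      ∀ A ∈ S, A = U * Matrix.diagonal (fun i => (d A i : ℂ)) * Uᴴ := by
  classical
  let T : S → (EuclideanSpace ℂ (Fin n) →ₗ[ℂ] EuclideanSpace ℂ (Fin n)) :=
    fun A => Matrix.toEuclideanLin A.1
  have hT : ∀ A, (T A).IsSymmetric := fun A =>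
    Matrix.isSymmetric_toEuclideanLin_iff.mpr (hherm A.1 A.2)
  have hC : Pairwise (Function.onFun Commute T) := by
    intro A B _
    show T A * T B = T B * T A
    ext1 x
    have h := hcomm A.1 A.2 B.1 B.2
    simp only [T, Module.End.mul_apply, Matrix.toLpLin_apply, Matrix.mulVec_mulVec, h]
  let V : (S → ℂ) → Submodule ℂ (EuclideanSpace ℂ (Fin n)) :=
    fun χ => ⨅ j, Module.End.eigenspace (T j) (χ j)
  have hV : OrthogonalFamily ℂ (fun χ => V χ) fun χ => (V χ).subtypeₗᵢ :=
    LinearMap.IsSymmetric.orthogonalFamily_iInf_eigenspaces hT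
  have htop : ⨆ χ, V χ = ⊤ := LinearMap.IsSymmetric.iSup_iInf_eq_top_of_commute hT hC
  let I := {χ // V χ ≠ ⊥}
  have hfin : Finite I := WellFoundedGT.finite_ne_bot_of_iSupIndep hV.independent
  have : Fintype I := Fintype.ofFinite I
  have hV' : OrthogonalFamily ℂ (fun χ : I => V χ.1) fun χ => (V χ.1).subtypeₗᵢ :=
    hV.comp Subtype.val_injective
  have hint : DirectSum.IsInternal (fun χ : I => V χ.1) := by
    rw [OrthogonalFamily.isInternal_iff hV', iSup_ne_bot_subtype, htop,
      Submodule.top_orthogonal_eq_bot]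
  have hn : Module.finrank ℂ (EuclideanSpace ℂ (Fin n)) = n := by simp
  let b := hint.subordinateOrthonormalBasis hn hV'
  let χ : Fin n → (S → ℂ) := fun a => (hint.subordinateOrthonormalBasisIndex hn a hV').1
  have hb : ∀ a, b a ∈ V (χ a) := fun a =>
    hint.subordinateOrthonormalBasis_subordinate hn a hV'
  let U : Matrix (Fin n) (Fin n) ℂ := Matrix.of fun i j => b j i
  have hU : Uᴴ * U = 1 := by
    ext i j
    have := orthonormal_iff_ite.mp b.orthonormal i j
    rw [Matrix.one_apply, ← this]
    simp [Matrix.mul_apply, U, PiLp.inner_apply, mul_comm]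
  have hU' : U * Uᴴ = 1 := mul_eq_one_comm.mp hU
  refine ⟨U, fun A i => ((Uᴴ * A * U) i i).re, hU, hU', ?_⟩
  intro A hA
  have hAU : A * U = U * Matrix.diagonal (fun i => χ i ⟨A, hA⟩) := by
    ext i j
    have h1 : b j ∈ Module.End.eigenspace (T ⟨A, hA⟩) (χ j ⟨A, hA⟩) :=
      (Submodule.mem_iInf _).mp (hb j) ⟨A, hA⟩
    rw [Module.End.mem_eigenspace_iff] at h1
    have h2 := congrArg (fun v : EuclideanSpace ℂ (Fin n) => v i) h1
    simp only [T, Matrix.toLpLin_apply, PiLp.smul_apply, smul_eq_mul] at h2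
    rw [Matrix.mul_diagonal, mul_comm]
    exact h2
  have hD : Uᴴ * A * U = Matrix.diagonal (fun i => χ i ⟨A, hA⟩) := by
    rw [mul_assoc, hAU, ← mul_assoc, hU, one_mul]
  have hH : (Uᴴ * A * U).IsHermitian := Matrix.isHermitian_conjTranspose_mul_mul U (hherm A hA)
  have hdiag : Matrix.diagonal (fun i => (((Uᴴ * A * U) i i).re : ℂ)) = Uᴴ * A * U := by
    have h3 : ∀ i, (((Uᴴ * A * U) i i).re : ℂ) = χ i ⟨A, hA⟩ := by
      intro i
      have := hH.coe_re_apply_self i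
      rw [hD, Matrix.diagonal_apply_eq] at this
      rw [hD, Matrix.diagonal_apply_eq]
      exact this
    simp only [h3]
    exact hD.symm
  rw [hdiag]
  simp only [← mul_assoc, hU', one_mul]
  rw [mul_assoc, hU', mul_one]

open Matrix in
theorem glb_aux {n : ℕ} (M : Set (Matrix (Fin n) (Fin n) ℂ)) (hne : M.Nonempty)
    (hbdd : ∃ L : Matrix (Fin n) (Fin n) ℂ, L.IsHermitian ∧ ∀ A ∈ M, matLoewnerLE L A)
    (U : Matrix (Fin n) (Fin n) ℂ) (d : Matrix (Fin n) (Fin n) ℂ → Fin n → ℝ)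
    (hU : Uᴴ * U = 1) 
    (hd : ∀ A ∈ M, A = U * Matrix.diagonal (fun i => (d A i : ℂ)) * Uᴴ) :
    ∃ m : Fin n → ℝ, (∀ A ∈ M, ∀ i, m i ≤ d A i) ∧
      (∀ i j, (∀ A ∈ M, d A i = d A j) → m i = m j) ∧
      (∀ L : Matrix (Fin n) (Fin n) ℂ, (∀ A ∈ M, matLoewnerLE L A) →
        ∀ i, ((Uᴴ * L * U) i i).re ≤ m i) := by
  have key : ∀ L : Matrix (Fin n) (Fin n) ℂ, (∀ A ∈ M, matLoewnerLE L A) →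
      ∀ i, ∀ A ∈ M, ((Uᴴ * L * U) i i).re ≤ d A i := by
    intro L hL i A hA
    have h1 := ((hL A hA).conjTranspose_mul_mul_same U).diag_nonneg (i := i)
    have h2 : Uᴴ * A * U = Matrix.diagonal (fun i => (d A i : ℂ)) := by
      conv_lhs => rw [hd A hA]
      simp only [← mul_assoc, hU, one_mul]
      rw [mul_assoc, hU, mul_one]
    rw [mul_sub, sub_mul, h2] at h1
    have h3 := (Complex.le_def.mp h1).1
    simp at h3
    exact h3
  obtain ⟨L, -, hL⟩ := hbdd
  refine ⟨fun i => sInf ((fun A => d A i) '' M), ?_, ?_, ?_⟩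
  · intro A hA i
    refine csInf_le ⟨((Uᴴ * L * U) i i).re, ?_⟩ ⟨A, hA, rfl⟩
    rintro _ ⟨B, hB, rfl⟩
    exact key L hL i B hB
  · intro i j h
    show sInf _ = sInf _
    congr 1
    exact Set.image_congr h
  · intro L hL i
    refine le_csInf (hne.image _) ?_
    rintro _ ⟨B, hB, rfl⟩
    exact key L hL i B hB

open Matrix in
theorem diag_le {n : ℕ} (U : Matrix (Fin n) (Fin n) ℂ) (a b : Fin n → ℝ) (h : ∀ i, a i ≤ b i) :
    matLoewnerLE (U * Matrix.diagonal (fun i => (a i : ℂ)) * Uᴴ)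
      (U * Matrix.diagonal (fun i => (b i : ℂ)) * Uᴴ) := by
  unfold matLoewnerLE
  rw [← sub_mul, ← mul_sub, Matrix.diagonal_sub]
  refine Matrix.PosSemidef.mul_mul_conjTranspose_same (Matrix.PosSemidef.diagonal ?_) U
  intro i
  have := h i
  simp only [Pi.zero_apply, ← Complex.ofReal_sub]
  exact Complex.zero_le_real.mpr (sub_nonneg.mpr this)

open Matrix in
theorem diag_herm {n : ℕ} (U : Matrix (Fin n) (Fin n) ℂ) (a : Fin n → ℝ) :
    (U * Matrix.diagonal (fun i => (a i : ℂ)) * Uᴴ).IsHermitian := by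
  refine Matrix.isHermitian_mul_mul_conjTranspose U ?_
  refine Matrix.isHermitian_diagonal_of_self_adjoint _ ?_
  ext i
  simp

open Matrix in
theorem conj_diag_cancel {n : ℕ} (U D : Matrix (Fin n) (Fin n) ℂ) (hU : Uᴴ * U = 1) :
    Uᴴ * (U * D * Uᴴ) * U = D := by
  simp only [← mul_assoc, hU, one_mul]
  rw [mul_assoc, hU, mul_one]

/-- Theorem 6.7: a nonempty set of pairwise commuting Hermitian `n × n` complex matrices
which is bounded from below has a unique maximal lower bound commuting with all its
elements. -/
theorem stmt18 (n : ℕ) (M : Set (Matrix (Fin n) (Fin n) ℂ)) (hne : M.Nonempty)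
    (hherm : ∀ A ∈ M, A.IsHermitian)
    (hcomm : ∀ A ∈ M, ∀ B ∈ M, A * B = B * A)
    (hbdd : ∃ L : Matrix (Fin n) (Fin n) ℂ, L.IsHermitian ∧ ∀ A ∈ M, matLoewnerLE L A) :
    ∃! Mo : Matrix (Fin n) (Fin n) ℂ,
      Mo.IsHermitian ∧ (∀ A ∈ M, matLoewnerLE Mo A) ∧
      (∀ L : Matrix (Fin n) (Fin n) ℂ, L.IsHermitian → (∀ A ∈ M, matLoewnerLE L A) →
        matLoewnerLE Mo L → L = Mo) ∧
      (∀ A ∈ M, Mo * A = A * Mo) := by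
  classical
  obtain ⟨U, d, hU, hU', hd⟩ := joint_diag M hherm hcomm
  obtain ⟨m, hm1, hm2, hm3⟩ := glb_aux M hne hbdd U d hU hd
  set Mo := U * Matrix.diagonal (fun i => (m i : ℂ)) * U.conjTranspose with hMo
  have hMoH : Mo.IsHermitian := diag_herm U m
  have hMoL : ∀ A ∈ M, matLoewnerLE Mo A := by
    intro A hA
    rw [hd A hA]
    exact diag_le U _ _ (hm1 A hA)
  have hMomax : ∀ L : Matrix (Fin n) (Fin n) ℂ, L.IsHermitian → (∀ A ∈ M, matLoewnerLE L A) →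
        matLoewnerLE Mo L → L = Mo := by
    intro L hLH hL hle
    have h1 := Matrix.PosSemidef.conjTranspose_mul_mul_same hle U
    have h2 : (U.conjTranspose * (L - Mo) * U).trace = 0 := by
      apply le_antisymm _ h1.trace_nonneg
      refine Finset.sum_nonpos fun i _ => ?_
      have h0 := h1.diag_nonneg (i := i)
      have h3 := hm3 L hL i
      rw [Matrix.diag_apply]
      refine Complex.le_def.mpr ⟨?_, (Complex.le_def.mp h0).2.symm⟩
      rw [mul_sub, sub_mul, hMo, conj_diag_cancel U _ hU]
      simpa using h3
    have h4 := h1.trace_eq_zero_iff.mp h2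
    have h5 : L - Mo = U * (U.conjTranspose * (L - Mo) * U) * U.conjTranspose := by
      simp only [← mul_assoc, hU', one_mul]
      rw [mul_assoc, hU', mul_one]
    rw [h4] at h5
    simpa [sub_eq_zero] using h5
  -- anything commuting with `M` commutes with `Mo`
  have hcommMo : ∀ N : Matrix (Fin n) (Fin n) ℂ, (∀ A ∈ M, N * A = A * N) →
      N * Mo = Mo * N := by
    intro N hN
    have hN' : N = U * (U.conjTranspose * N * U) * U.conjTranspose := by
      simp only [← mul_assoc, hU', one_mul]
      rw [mul_assoc, hU', mul_one]
    set N' := U.conjTranspose * N * U with hN'def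
    have hprod : ∀ X Y : Matrix (Fin n) (Fin n) ℂ,
        (U * X * U.conjTranspose) * (U * Y * U.conjTranspose) = U * (X * Y) * U.conjTranspose := by
      intro X Y
      calc _ = U * X * (U.conjTranspose * U) * Y * U.conjTranspose := by
            simp only [mul_assoc]
        _ = _ := by rw [hU, mul_one]; simp only [mul_assoc]
    have hent : ∀ A ∈ M, N' * Matrix.diagonal (fun i => (d A i : ℂ))
        = Matrix.diagonal (fun i => (d A i : ℂ)) * N' := by
      intro A hA
      have h := hN A hA
      rw [hN', hd A hA, hprod, hprod] at h
      have h' := congrArg (fun X => U.conjTranspose * X * U) h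
      simpa only [conj_diag_cancel U _ hU] using h'
    rw [hN', hMo, hprod, hprod]
    congr 2
    ext i j
    rw [Matrix.mul_diagonal, Matrix.diagonal_mul]
    by_cases hz : N' i j = 0
    · simp [hz]
    · have : m i = m j := by
        apply hm2
        intro A hA
        have h := congrFun (congrFun (hent A hA) i) j
        rw [Matrix.mul_diagonal, Matrix.diagonal_mul, mul_comm] at h
        exact_mod_cast (mul_right_cancel₀ hz h).symm
      rw [this, mul_comm]
  have hMoC : ∀ A ∈ M, Mo * A = A * Mo := fun A hA =>
    (hcommMo A (fun B hB => hcomm A hA B hB)).symm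
  refine ⟨Mo, ⟨hMoH, hMoL, hMomax, hMoC⟩, ?_⟩
  rintro N ⟨hNH, hNL, hNmax, hNC⟩
  have hNMo := hcommMo N hNC
  obtain ⟨W, e, hW, hW', he⟩ := joint_diag (insert N (insert Mo M))
    (by
      rintro A (rfl | rfl | hA)
      · exact hNH
      · exact hMoH
      · exact hherm A hA)
    (by
      rintro A (rfl | rfl | hA) B (rfl | rfl | hB)
      · rfl
      · exact hNMo
      · exact hNC B hB
      · exact hNMo.symm
      · rfl
      · exact hMoC B hB
      · exact (hNC A hA).symm
      · exact (hMoC A hA).symm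
      · exact hcomm A hA B hB)
  have heM : ∀ A ∈ M, A = W * Matrix.diagonal (fun i => (e A i : ℂ)) * W.conjTranspose :=
    fun A hA => he A (Or.inr (Or.inr hA))
  obtain ⟨p, hp1, -, hp3⟩ := glb_aux M hne hbdd W e hW heM
  have hPL : ∀ A ∈ M,
      matLoewnerLE (W * Matrix.diagonal (fun i => (p i : ℂ)) * W.conjTranspose) A := by
    intro A hA
    have := diag_le W _ _ (hp1 A hA)
    rwa [← heM A hA] at this
  have hle : ∀ X ∈ insert N (insert Mo M), (∀ A ∈ M, matLoewnerLE X A) →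
      matLoewnerLE X (W * Matrix.diagonal (fun i => (p i : ℂ)) * W.conjTranspose) := by
    intro X hX hXL
    have h1 : ∀ i, e X i ≤ p i := by
      intro i
      have h := hp3 X hXL i
      rw [he X hX, conj_diag_cancel W _ hW] at h
      simpa using h
    have := diag_le W _ _ h1
    rwa [← he X hX] at this
  have hP1 := hNmax _ (diag_herm W p) hPL (hle N (Or.inl rfl) hNL)
  have hP2 := hMomax _ (diag_herm W p) hPL (hle Mo (Or.inr (Or.inl rfl)) hMoL)
  exact hP1.symm.trans hP2
end
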